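/- Let m ≥ 1 and 1 ≤ k ≤ m be integers. The Gårding cone Γ_k^+ = {κ ∈ ℝ^m : σ_j(κ) > 0 for j = 1,…,k} is a convex cone: it is a convex subset of ℝ^m, and if κ ∈ Γ_k^+ and t > 0 then tκ ∈ Γ_k^+. -/

import Mathlib

/-- The `j`-th elementary symmetric polynomial of `κ = (κ_1, …, κ_m) ∈ ℝ^m`,
with the conventions `σ_0 = 1` and `σ_j = 0` for `j > m`. -/
noncomputable def esymm (m j : ℕ) (κ : Fin m → ℝ) : ℝ :=
  ∑ s ∈ Finset.powersetCard j (Finset.univ : Finset (Fin m)), ∏ i ∈ s, κ i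

/-- `σ_{k;i}(κ)`: the `k`-th elementary symmetric polynomial of the `m - 1` numbers
`κ_1, …, κ_{i-1}, κ_{i+1}, …, κ_m`. -/
noncomputable def esymmWithout (m k : ℕ) (i : Fin m) (κ : Fin m → ℝ) : ℝ :=
  ∑ s ∈ Finset.powersetCard k ((Finset.univ : Finset (Fin m)).erase i), ∏ j ∈ s, κ j

/-- The Gårding cone `Γ_k^+ = {κ ∈ ℝ^m : σ_j(κ) > 0 for j = 1, …, k}`. -/
def gardingCone (m k : ℕ) : Set (Fin m → ℝ) :=
  {κ | ∀ j, 1 ≤ j → j ≤ k → 0 < esymm m j κ}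

open Polynomial in
lemma g_splits_derivative (p : ℝ[X]) (hp : p.Splits) : (derivative p).Splits := by
  rcases eq_or_ne (derivative p) 0 with h | h
  · rw [h]; exact Splits.zero
  rw [splits_iff_card_roots] at hp ⊢
  have h1 := card_roots_le_derivative p
  have h2 := card_roots' (derivative p)
  have h3 := natDegree_derivative_le p
  have h4 : p.natDegree ≠ 0 := by
    intro h0
    apply h
    rw [eq_C_of_natDegree_eq_zero h0]; simp
  omega

open Polynomial in
lemma g_laguerre (p : ℝ[X]) (hp : p.Splits) (x : ℝ) :
    p.eval x * (derivative (derivative p)).eval x ≤ ((derivative p).eval x) ^ 2 := by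
  rw [hp.eq_prod_roots]
  generalize p.roots = s
  generalize p.leadingCoeff = a
  induction s using Multiset.induction_on with
  | empty => simp
  | cons r s ih =>
    have e : (C a * (Multiset.map (fun a => X - C a) (r ::ₘ s)).prod)
      = (X - C r) * (C a * (Multiset.map (fun a => X - C a) s).prod) := by
      simp only [Multiset.map_cons, Multiset.prod_cons]; ring
    rw [e]
    generalize C a * (Multiset.map (fun a => X - C a) s).prod = q at ih
    simp only [derivative_mul, derivative_sub, derivative_X, derivative_C, derivative_add,
      eval_add, eval_mul, eval_sub, eval_X, eval_C, sub_zero, one_mul]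
    nlinarith [sq_nonneg (eval x q), mul_nonneg (sq_nonneg (x - r)) (sub_nonneg.2 ih)]

open Polynomial in
lemma g_newton' (j : ℕ) : ∀ (p : ℝ[X]), p.Splits →
    ((j : ℝ) + 2) * (p.coeff j * p.coeff (j + 2)) ≤ ((j : ℝ) + 1) * p.coeff (j + 1) ^ 2 := by
  induction j with
  | zero =>
    intro p hp
    have := g_laguerre p hp 0
    simp only [← coeff_zero_eq_eval_zero, coeff_derivative] at this
    norm_num at this ⊢
    linarith
  | succ j ih =>
    intro p hp
    have := ih _ (g_splits_derivative p hp)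
    simp only [coeff_derivative] at this
    push_cast at this ⊢
    have hpos : (0 : ℝ) < ((j : ℝ) + 1) * (j + 2) := by positivity
    refine le_of_mul_le_mul_left ?_ hpos
    have e1 : j + 1 + 1 = j + 2 := rfl
    have e2 : j + 2 + 1 = j + 3 := rfl
    have e3 : j + 1 + 2 = j + 3 := by omega
    rw [e1, e2] at this
    rw [e1, e3]
    linarith

open Polynomial in
lemma g_newton (p : ℝ[X]) (hp : p.Splits) (j : ℕ) :
    p.coeff j * p.coeff (j + 2) ≤ p.coeff (j + 1) ^ 2 := by
  have h := g_newton' j p hp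
  rcases le_or_gt (p.coeff j * p.coeff (j + 2)) 0 with h0 | h0
  · exact h0.trans (sq_nonneg _)
  · have hpos : (0 : ℝ) < (j : ℝ) + 1 := by positivity
    refine le_of_mul_le_mul_left ?_ hpos
    linarith

open Polynomial in
noncomputable def gF {ι : Type*} (s : Finset ι) (x : ι → ℝ) : ℝ[X] := ∏ i ∈ s, (1 + C (x i) * X)

noncomputable def gE {ι : Type*} (s : Finset ι) (j : ℕ) (x : ι → ℝ) : ℝ := (gF s x).coeff j

open Polynomial in
lemma gF_splits {ι : Type*} (s : Finset ι) (x : ι → ℝ) : (gF s x).Splits := by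
  unfold gF
  apply Splits.prod
  intro i _
  apply Splits.of_natDegree_le_one
  compute_degree

open Polynomial in
lemma gE_zero {ι : Type*} (s : Finset ι) (x : ι → ℝ) : gE s 0 x = 1 := by
  simp [gE, gF, coeff_zero_eq_eval_zero, eval_prod]

open Polynomial in
lemma gE_erase {ι : Type*} [DecidableEq ι] (s : Finset ι) (x : ι → ℝ) (i : ι) (hi : i ∈ s) (j : ℕ) :
    gE s (j + 1) x = gE (s.erase i) (j + 1) x + x i * gE (s.erase i) j x := by
  unfold gE
  have : gF s x = gF (s.erase i) x + C (x i) * (gF (s.erase i) x * X) := by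
    unfold gF
    rw [← Finset.mul_prod_erase s _ hi]; ring
  rw [this, coeff_add, coeff_C_mul, coeff_mul_X]

open Polynomial in
lemma gE_sum {ι : Type*} [DecidableEq ι] (s : Finset ι) (x : ι → ℝ) (j : ℕ) :
    ((j : ℝ) + 1) * gE s (j + 1) x = ∑ i ∈ s, x i * gE (s.erase i) j x := by
  have h : (derivative (gF s x)) = ∑ i ∈ s, C (x i) * gF (s.erase i) x := by
    unfold gF
    rw [derivative_prod_finset]
    refine Finset.sum_congr rfl fun i _ => ?_
    rw [mul_comm]; simp
  have h2 := congrArg (fun p => coeff p j) h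
  simp only [coeff_derivative, finsetSum_coeff, coeff_C_mul] at h2
  unfold gE
  rw [← h2]; ring

open Polynomial in
lemma gE_eq (m j : ℕ) (x : Fin m → ℝ) : esymm m j x = gE Finset.univ j x := by
  unfold gE gF esymm
  rw [Finset.prod_one_add, finsetSum_coeff, Finset.powersetCard_eq_filter, Finset.sum_filter]
  refine Finset.sum_congr rfl fun t _ => ?_
  rw [Finset.prod_mul_distrib, Finset.prod_const, ← map_prod, coeff_C_mul, coeff_X_pow]
  by_cases h : t.card = j
  · simp [h]
  · simp [h, Ne.symm h]

def gG {ι : Type*} (k : ℕ) (s : Finset ι) (x : ι → ℝ) : Prop := ∀ j ≤ k, 0 < gE s j x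

lemma gG_erase {ι : Type*} [DecidableEq ι] (s : Finset ι) (x : ι → ℝ) (i : ι) (hi : i ∈ s) (k : ℕ) :
    gG (k + 1) s x → gG k (s.erase i) x := by
  induction k with
  | zero =>
    intro _ j hj
    obtain rfl : j = 0 := by omega
    rw [gE_zero]; norm_num
  | succ k ih =>
    intro h
    have ih' := ih (fun j hj => h j (by omega))
    intro j hj
    rcases Nat.lt_or_ge j (k + 1) with h1 | h1
    · exact ih' j (by omega)
    obtain rfl : j = k + 1 := by omega
    have ha := ih' k le_rfl
    have hb := h (k + 1) (by omega)
    have hc := h (k + 2) (by omega)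
    rw [gE_erase s x i hi] at hb hc
    have hn := g_newton _ (gF_splits (s.erase i) x) k
    change gE _ _ _ * gE _ _ _ ≤ gE _ _ _ ^ 2 at hn
    by_contra hneg
    push Not at hneg
    rw [show k + 1 + 1 = k + 2 from rfl] at hc
    generalize gE (s.erase i) k x = a at *
    generalize gE (s.erase i) (k + 1) x = b at *
    generalize gE (s.erase i) (k + 2) x = c at *
    nlinarith [mul_pos ha hc, mul_nonneg (neg_nonneg.2 hneg) hb.le]

lemma g_titu (x y A B D : ℝ) (hA : 0 < A) (hB : 0 < B) (hD : A + B ≤ D) :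
    (x + y) ^ 2 / D ≤ x ^ 2 / A + y ^ 2 / B := by
  have h1 : (x + y) ^ 2 / D ≤ (x + y) ^ 2 / (A + B) := by gcongr
  refine h1.trans ?_
  rw [div_add_div _ _ hA.ne' hB.ne', div_le_div_iff₀ (by positivity) (by positivity)]
  nlinarith [mul_nonneg (mul_pos hA hB).le (sq_nonneg (x * B - y * A)), sq_nonneg (x * B - y * A)]

lemma g_quot {ι : Type*} [DecidableEq ι] (s : Finset ι) (x : ι → ℝ) (k : ℕ)
    (h : gG (k + 1) s x) (h' : ∀ i ∈ s, 0 < gE (s.erase i) k x) :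
    ((k : ℝ) + 2) * (gE s (k + 2) x / gE s (k + 1) x) =
      ∑ i ∈ s, (x i - x i ^ 2 / (x i + gE (s.erase i) (k + 1) x / gE (s.erase i) k x)) := by
  have := gE_sum s x (k + 1)
  push_cast at this
  rw [mul_div_assoc', show (k : ℝ) + 2 = k + 1 + 1 by ring, show k + 2 = k + 1 + 1 from rfl,
    this, Finset.sum_div]
  refine Finset.sum_congr rfl fun i hi => ?_
  have ha := h' i hi
  have hb := h (k + 1) le_rfl
  rw [gE_erase s x i hi] at hb ⊢
  generalize gE (s.erase i) k x = a at *
  generalize gE (s.erase i) (k + 1) x = b at *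
  have e : x i + b / a = (b + x i * a) / a := by field_simp; ring
  rw [e]
  field_simp
  ring

lemma g_main {ι : Type*} [DecidableEq ι] (k : ℕ) : ∀ (s : Finset ι) (x y : ι → ℝ),
    gG (k + 1) s x → gG (k + 1) s y → gG (k + 1) s (x + y) ∧
    gE s (k + 1) x / gE s k x + gE s (k + 1) y / gE s k y ≤
      gE s (k + 1) (x + y) / gE s k (x + y) := by
  induction k with
  | zero =>
    intro s x y hx hy
    have e1 : ∀ z : ι → ℝ, gE s 1 z = ∑ i ∈ s, z i := by
      intro z
      have := gE_sum s z 0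
      simpa [gE_zero] using this
    have e2 : gE s 1 (x + y) = gE s 1 x + gE s 1 y := by
      simp [e1, Finset.sum_add_distrib]
    refine ⟨?_, by simp [gE_zero, e2]⟩
    intro j hj
    rcases Nat.lt_or_ge j 1 with h | h
    · obtain rfl : j = 0 := by omega
      rw [gE_zero]; norm_num
    · obtain rfl : j = 1 := by omega
      rw [e2]
      exact add_pos (hx 1 le_rfl) (hy 1 le_rfl)
  | succ k ih =>
    intro s x y hx hy
    have hx1 : gG (k + 1) s x := fun j hj => hx j (by omega)
    have hy1 : gG (k + 1) s y := fun j hj => hy j (by omega)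
    have hxy := (ih s x y hx1 hy1).1
    have hxi : ∀ i ∈ s, gG (k + 1) (s.erase i) x := fun i hi => gG_erase s x i hi _ hx
    have hyi : ∀ i ∈ s, gG (k + 1) (s.erase i) y := fun i hi => gG_erase s y i hi _ hy
    have hi := fun i hi => ih (s.erase i) x y (hxi i hi) (hyi i hi)
    have key : gE s (k + 1 + 1) x / gE s (k + 1) x + gE s (k + 1 + 1) y / gE s (k + 1) y ≤
      gE s (k + 1 + 1) (x + y) / gE s (k + 1) (x + y) := by
      have hpos : (0 : ℝ) < (k : ℝ) + 2 := by positivity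
      refine le_of_mul_le_mul_left ?_ hpos
      rw [mul_add, g_quot s x k hx1 fun i hi => hxi i hi k (by omega),
        g_quot s y k hy1 fun i hi => hyi i hi k (by omega),
        g_quot s (x + y) k hxy fun i hh => (hi i hh).1 k (by omega), ← Finset.sum_add_distrib]
      refine Finset.sum_le_sum fun i his => ?_
      have aux : ∀ z : ι → ℝ, gG (k + 1) s z → gG (k + 1) (s.erase i) z →
          0 < z i + gE (s.erase i) (k + 1) z / gE (s.erase i) k z := by
        intro z hz hzi
        have ha := hzi k (by omega)
        have hb := hz (k + 1) le_rfl
        rw [gE_erase s z i his] at hb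
        have e : z i + gE (s.erase i) (k + 1) z / gE (s.erase i) k z =
          (gE (s.erase i) (k + 1) z + z i * gE (s.erase i) k z) / gE (s.erase i) k z := by
          field_simp; ring
        rw [e]
        exact div_pos hb ha
      have t := g_titu (x i) (y i) _ _
        ((x + y) i + gE (s.erase i) (k + 1) (x + y) / gE (s.erase i) k (x + y))
        (aux x hx1 (hxi i his)) (aux y hy1 (hyi i his))
        (by have := (hi i his).2; rw [Pi.add_apply]; linarith)
      have e : (x + y) i = x i + y i := rfl
      rw [e] at t ⊢
      linarith
    refine ⟨?_, key⟩
    intro j hj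
    rcases Nat.lt_or_ge j (k + 2) with h | h
    · exact hxy j (by omega)
    obtain rfl : j = k + 1 + 1 := by omega
    have p1 := div_pos (hx (k + 1 + 1) le_rfl) (hx (k + 1) (by omega))
    have p2 := div_pos (hy (k + 1 + 1) le_rfl) (hy (k + 1) (by omega))
    have p3 := hxy (k + 1) le_rfl
    exact (div_pos_iff_of_pos_right p3).1 (by linarith)

lemma g_mem (m k : ℕ) (x : Fin m → ℝ) : x ∈ gardingCone m k ↔ gG k Finset.univ x := by
  constructor
  · intro h j hj
    rcases Nat.eq_zero_or_pos j with rfl | h0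
    · rw [gE_zero]; norm_num
    · rw [← gE_eq]; exact h j h0 hj
  · intro h j _ hj
    rw [gE_eq]; exact h j hj

lemma g_smul (m k : ℕ) (x : Fin m → ℝ) (hx : x ∈ gardingCone m k) (t : ℝ) (ht : 0 < t) :
    t • x ∈ gardingCone m k := by
  intro j h1 h2
  have : esymm m j (t • x) = t ^ j * esymm m j x := by
    unfold esymm
    rw [Finset.mul_sum]
    refine Finset.sum_congr rfl fun s hs => ?_
    simp [Finset.prod_mul_distrib, (Finset.mem_powersetCard.1 hs).2]
  rw [this]
  exact mul_pos (pow_pos ht j) (hx j h1 h2)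

/-- The Gårding cone is a convex cone. -/
theorem stmt_6 (m k : ℕ) (hm : 1 ≤ m) (hk1 : 1 ≤ k) (hk2 : k ≤ m) :
    Convex ℝ (gardingCone m k) ∧
    (∀ κ ∈ gardingCone m k, ∀ t : ℝ, 0 < t → t • κ ∈ gardingCone m k) := by
  refine ⟨?_, fun κ h t ht => g_smul m k κ h t ht⟩
  rw [convex_iff_forall_pos]
  intro x hx y hy a b ha hb _
  have h1 := (g_mem m k _).1 (g_smul m k x hx a ha)
  have h2 := (g_mem m k _).1 (g_smul m k y hy b hb)
  obtain ⟨n, rfl⟩ : ∃ n, k = n + 1 := ⟨k - 1, by omega⟩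
  exact (g_mem m _ _).2 (g_main n _ _ _ h1 h2).1
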